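/- A permutation w ∈ S_n is boolean, i.e., its principal order ideal B(w) in the Bruhat order is order-isomorphic to the boolean lattice of all subsets of {1,...,r} for some r ≥ 0, if and only if w avoids both of the patterns 321 and 3412. -/

import Mathlib

namespace Paper

/-! ### Type A: the symmetric group `S_n` as `Equiv.Perm (Fin n)` -/

/-- The simple transposition `s_i ∈ S_n` (1-indexed letter `i`, meaningful for
`1 ≤ i ≤ n-1`): it interchanges the entries in (1-indexed) positions `i` and `i+1`,
i.e. (0-indexed) positions `i-1` and `i` of `Fin n`. Out-of-range letters give `1`. -/
def sA (n : ℕ) (i : ℕ) : Equiv.Perm (Fin n) :=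
  if h : 1 ≤ i ∧ i < n then Equiv.swap ⟨i - 1, by omega⟩ ⟨i, h.2⟩ else 1

/-- The product `s_{i_1} ⋯ s_{i_ℓ}` of a word `i_1 ⋯ i_ℓ`. -/
def prodA (n : ℕ) (w : List ℕ) : Equiv.Perm (Fin n) := (w.map (sA n)).prod

/-- A word in the letters `{1, …, n-1}`. -/
def IsWordA (n : ℕ) (w : List ℕ) : Prop := ∀ i ∈ w, 1 ≤ i ∧ i ≤ n - 1

/-- `w` is a reduced decomposition of `x ∈ S_n`. -/
def ReducedA (n : ℕ) (w : List ℕ) (x : Equiv.Perm (Fin n)) : Prop :=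
  IsWordA n w ∧ prodA n w = x ∧
    ∀ w' : List ℕ, IsWordA n w' → prodA n w' = x → w.length ≤ w'.length

/-- The Coxeter length `ℓ(x)`: minimal length of a word for `x`. -/
noncomputable def lenA (n : ℕ) (x : Equiv.Perm (Fin n)) : ℕ :=
  sInf {l | ∃ w : List ℕ, IsWordA n w ∧ prodA n w = x ∧ w.length = l}

/-- Bruhat order on `S_n`: `v ≤ w` iff some reduced decomposition of `v` is a
(not necessarily consecutive) subword of some reduced decomposition of `w`. -/
def bruhatA (n : ℕ) (v w : Equiv.Perm (Fin n)) : Prop :=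
  ∃ a b : List ℕ, ReducedA n a v ∧ ReducedA n b w ∧ a.Sublist b

/-- `w ∈ S_n` is boolean: the principal order ideal `B(w)`, ordered by the Bruhat
order, is order-isomorphic to the lattice of all subsets of `{1,…,r}` for some `r`. -/
def BooleanA (n : ℕ) (w : Equiv.Perm (Fin n)) : Prop :=
  ∃ (r : ℕ) (e : {v : Equiv.Perm (Fin n) // bruhatA n v w} ≃ Finset (Fin r)),
    ∀ a b : {v : Equiv.Perm (Fin n) // bruhatA n v w}, bruhatA n a.1 b.1 ↔ e a ⊆ e b

/-- Pattern containment: `w ∈ S_n` contains `p ∈ S_k`. -/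
def ContainsA {n k : ℕ} (w : Equiv.Perm (Fin n)) (p : Equiv.Perm (Fin k)) : Prop :=
  ∃ f : Fin k → Fin n, StrictMono f ∧ ∀ a b : Fin k, w (f a) < w (f b) ↔ p a < p b

/-- Pattern avoidance. -/
def AvoidsA {n k : ℕ} (w : Equiv.Perm (Fin n)) (p : Equiv.Perm (Fin k)) : Prop :=
  ¬ ContainsA w p

/-- The pattern `321` (one-line notation). -/
def p321 : Equiv.Perm (Fin 3) := ⟨![2,1,0], ![2,1,0], by decide, by decide⟩
/-- The pattern `231` (one-line notation). -/
def p231 : Equiv.Perm (Fin 3) := ⟨![1,2,0], ![2,0,1], by decide, by decide⟩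
/-- The pattern `312` (one-line notation). -/
def p312 : Equiv.Perm (Fin 3) := ⟨![2,0,1], ![1,2,0], by decide, by decide⟩
/-- The pattern `3412` (one-line notation). -/
def p3412 : Equiv.Perm (Fin 4) := ⟨![2,3,0,1], ![2,3,0,1], by decide, by decide⟩

/-- The longest (decreasing) permutation `w_0^{(k)} = k (k-1) ⋯ 2 1 ∈ S_k`. -/
def w0 (k : ℕ) : Equiv.Perm (Fin k) := Fin.revPerm

/-- The shift of a word by `M`: each letter `i` becomes `i + M`. -/
def shift (M : ℕ) (w : List ℕ) : List ℕ := w.map (· + M)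




/-! ### Types B and D: signed permutations, modelled as permutations `w` of `ℤ`
with `w(-x) = -w(x)` that fix all integers of absolute value `> n`. -/

/-- The simple generators of `S_n^B`, as permutations of `ℤ`:
`sB 0` negates the value `1`; for `i ≥ 1`, `sB i` interchanges the values
`i` and `i+1` (and `-i` and `-(i+1)`). -/
def sB : ℕ → Equiv.Perm ℤ
  | 0 => Equiv.swap 1 (-1)
  | (i+1) => Equiv.swap ((i : ℤ) + 1) ((i : ℤ) + 2) * Equiv.swap (-((i : ℤ) + 1)) (-((i : ℤ) + 2))

/-- The simple generators of `S_n^D`: letter `0` encodes `s_{1'} = s_0 s_1 s_0`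
(mapping `1 ↦ -2` and `2 ↦ -1`), and letters `i ≥ 1` are as in type `B`. -/
def sD : ℕ → Equiv.Perm ℤ
  | 0 => sB 0 * sB 1 * sB 0
  | (i+1) => sB (i+1)

def prodB (w : List ℕ) : Equiv.Perm ℤ := (w.map sB).prod
def prodD (w : List ℕ) : Equiv.Perm ℤ := (w.map sD).prod

/-- A word in the type `B`/`D` letters `{0, 1, …, n-1}`. -/
def IsWordBD (n : ℕ) (w : List ℕ) : Prop := ∀ i ∈ w, i ≤ n - 1

/-- `w` is a reduced decomposition of `x ∈ S_n^B`. -/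
def ReducedB (n : ℕ) (w : List ℕ) (x : Equiv.Perm ℤ) : Prop :=
  IsWordBD n w ∧ prodB w = x ∧
    ∀ w' : List ℕ, IsWordBD n w' → prodB w' = x → w.length ≤ w'.length

/-- `w` is a reduced decomposition of `x ∈ S_n^D`. -/
def ReducedD (n : ℕ) (w : List ℕ) (x : Equiv.Perm ℤ) : Prop :=
  IsWordBD n w ∧ prodD w = x ∧
    ∀ w' : List ℕ, IsWordBD n w' → prodD w' = x → w.length ≤ w'.length

/-- Length in `S_n^B`. -/
noncomputable def lenB (n : ℕ) (x : Equiv.Perm ℤ) : ℕ :=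
  sInf {l | ∃ w : List ℕ, IsWordBD n w ∧ prodB w = x ∧ w.length = l}

/-- Length in `S_n^D`. -/
noncomputable def lenD (n : ℕ) (x : Equiv.Perm ℤ) : ℕ :=
  sInf {l | ∃ w : List ℕ, IsWordBD n w ∧ prodD w = x ∧ w.length = l}

/-- Bruhat order on `S_n^B`. -/
def bruhatB (n : ℕ) (v w : Equiv.Perm ℤ) : Prop :=
  ∃ a b : List ℕ, ReducedB n a v ∧ ReducedB n b w ∧ a.Sublist b

/-- Bruhat order on `S_n^D`. -/
def bruhatD (n : ℕ) (v w : Equiv.Perm ℤ) : Prop :=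
  ∃ a b : List ℕ, ReducedD n a v ∧ ReducedD n b w ∧ a.Sublist b

/-- `w` is an element of `S_n^B`: an "odd" permutation of `{±1, …, ±n}`. -/
def IsSignedPerm (n : ℕ) (w : Equiv.Perm ℤ) : Prop :=
  (∀ x : ℤ, w (-x) = - w x) ∧ ∀ x : ℤ, (n : ℤ) < |x| → w x = x

/-- `w` is an element of `S_n^D`: a signed permutation with an even number of
negative values in its one-line notation. -/
def IsTypeD (n : ℕ) (w : Equiv.Perm ℤ) : Prop :=
  IsSignedPerm n w ∧ Even (((Finset.Icc (1 : ℤ) n).filter (fun x => w x < 0)).card)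

/-- `w ∈ S_n^B` is boolean (for the type `B` Bruhat order). -/
def BooleanB (n : ℕ) (w : Equiv.Perm ℤ) : Prop :=
  ∃ (r : ℕ) (e : {v : Equiv.Perm ℤ // bruhatB n v w} ≃ Finset (Fin r)),
    ∀ a b : {v : Equiv.Perm ℤ // bruhatB n v w}, bruhatB n a.1 b.1 ↔ e a ⊆ e b

/-- `w ∈ S_n^D` is boolean (for the type `D` Bruhat order). -/
def BooleanD (n : ℕ) (w : Equiv.Perm ℤ) : Prop :=
  ∃ (r : ℕ) (e : {v : Equiv.Perm ℤ // bruhatD n v w} ≃ Finset (Fin r)),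
    ∀ a b : {v : Equiv.Perm ℤ // bruhatD n v w}, bruhatD n a.1 b.1 ↔ e a ⊆ e b

/-- Signed pattern containment, where the pattern is given by its one-line
notation `p` (a list of nonzero integers): there are positions
`1 ≤ f 0 < ⋯ < f (k-1) ≤ n` such that each `w (f j)` has the same sign as the
`j`-th entry of `p`, and the absolute values appear in the same relative order. -/
def containsPat (n : ℕ) (w : Equiv.Perm ℤ) (p : List ℤ) : Prop :=
  ∃ f : Fin p.length → ℤ, StrictMono f ∧ (∀ j, 1 ≤ f j ∧ f j ≤ (n : ℤ)) ∧
    (∀ j, 0 < w (f j) ↔ 0 < p.get j) ∧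
    (∀ j j', |w (f j)| < |w (f j')| ↔ |p.get j| < |p.get j'|)

/-- Signed pattern avoidance. -/
def avoidsPat (n : ℕ) (w : Equiv.Perm ℤ) (p : List ℤ) : Prop := ¬ containsPat n w p


/-! ### Extra definitions used in some statements -/

/-- `w ∈ S_n` is decomposable: `B(w) ≅ B(u) × B(v)` (as posets under Bruhat order)
for some `u ∈ S_m`, `v ∈ S_{m'}` with `m, m' < n`. -/
def Decomposable (n : ℕ) (w : Equiv.Perm (Fin n)) : Prop :=
  ∃ (m m' : ℕ), m < n ∧ m' < n ∧
    ∃ (u : Equiv.Perm (Fin m)) (v : Equiv.Perm (Fin m'))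
      (e : {x : Equiv.Perm (Fin n) // bruhatA n x w} ≃
        {y : Equiv.Perm (Fin m) // bruhatA m y u} × {z : Equiv.Perm (Fin m') // bruhatA m' z v}),
      ∀ a b : {x : Equiv.Perm (Fin n) // bruhatA n x w},
        bruhatA n a.1 b.1 ↔
          (bruhatA m ((e a).1).1 ((e b).1).1 ∧ bruhatA m' ((e a).2).1 ((e b).2).1)

/-- `w` is decreasing on the set of positions `T`. -/
def DecrOn (n : ℕ) (w : Equiv.Perm (Fin n)) (T : Finset (Fin n)) : Prop :=
  ∀ a ∈ T, ∀ b ∈ T, a < b → w b < w a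

/-- Every inversion of `w` lies in exactly one occurrence of the decreasing
pattern `w_0^{(k)}`: for every `i < j` with `w i > w j` there is exactly one
`k`-element set of positions containing `i` and `j` on which `w` is decreasing. -/
def EveryInvOnce (n k : ℕ) (w : Equiv.Perm (Fin n)) : Prop :=
  ∀ i j : Fin n, i < j → w j < w i →
    ∃! T : Finset (Fin n), T.card = k ∧ DecrOn n w T ∧ i ∈ T ∧ j ∈ T

/-- Equality of two patterns of (possibly a priori different) sizes. -/
def EqPat {k m : ℕ} (p : Equiv.Perm (Fin k)) (q : Equiv.Perm (Fin m)) : Prop :=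
  ∃ h : k = m, ∀ i : Fin k, ((p i : ℕ) = (q (Fin.cast h i) : ℕ))

/-- `L(n,k)`: the number of boolean permutations in `S_n` of length `k`. -/
noncomputable def LA (n k : ℕ) : ℕ :=
  Nat.card {w : Equiv.Perm (Fin n) // BooleanA n w ∧ lenA n w = k}

/-- `L` extended to integer arguments, with the convention that it vanishes
when `m < 1` or `j < 0`. -/
noncomputable def Lz (m j : ℤ) : ℤ :=
  if 1 ≤ m ∧ 0 ≤ j then (LA m.toNat j.toNat : ℤ) else 0

/-- `L^D(n,k)`: the number of boolean elements of `S_n^D` of length `k`. -/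
noncomputable def LD (n k : ℕ) : ℕ :=
  Nat.card {w : Equiv.Perm ℤ // IsTypeD n w ∧ BooleanD n w ∧ lenD n w = k}

/-! ### Helper lemmas -/

/-- `v` preserves the set of positions `{0, …, i-1}`. -/
def Pres (n i : ℕ) (v : Equiv.Perm (Fin n)) : Prop :=
  ∀ x : Fin n, (v x : ℕ) < i ↔ (x : ℕ) < i

theorem sA_val {n i : ℕ} (h1 : 1 ≤ i) (h2 : i < n) (x : Fin n) :
    (sA n i x : ℕ) = if (x : ℕ) = i - 1 then i else if (x : ℕ) = i then i - 1 else x := by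
  unfold sA
  rw [dif_pos ⟨h1, h2⟩, Equiv.swap_apply_def]
  simp only [Fin.ext_iff]
  split_ifs <;> rfl

theorem sA_mul_self (n i : ℕ) : sA n i * sA n i = 1 := by
  unfold sA
  split_ifs <;> simp

theorem prodA_nil (n : ℕ) : prodA n [] = 1 := rfl

theorem prodA_cons (n i : ℕ) (a : List ℕ) : prodA n (i :: a) = sA n i * prodA n a := by
  simp [prodA]

theorem prodA_append (n : ℕ) (a b : List ℕ) : prodA n (a ++ b) = prodA n a * prodA n b := by
  simp [prodA]

theorem pres_one (n i : ℕ) : Pres n i 1 := fun _ => Iff.rfl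

theorem Pres.mul {n i : ℕ} {u v : Equiv.Perm (Fin n)} (hu : Pres n i u) (hv : Pres n i v) :
    Pres n i (u * v) := fun x => (hu (v x)).trans (hv x)

theorem Pres.left {n i : ℕ} {u v : Equiv.Perm (Fin n)} (h : Pres n i (u * v))
    (hv : Pres n i v) : Pres n i u := by
  intro x
  obtain ⟨y, rfl⟩ := v.surjective x
  exact (h y).trans (hv y).symm

theorem Pres.right {n i : ℕ} {u v : Equiv.Perm (Fin n)} (h : Pres n i (u * v))
    (hu : Pres n i u) : Pres n i v := fun x => (hu (v x)).symm.trans (h x)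

theorem pres_sA {n i j : ℕ} (h : i ≠ j) : Pres n i (sA n j) := by
  by_cases hj : 1 ≤ j ∧ j < n
  · intro x
    rw [sA_val hj.1 hj.2]
    split_ifs <;> omega
  · unfold sA
    rw [dif_neg hj]
    exact pres_one n i

theorem not_pres_sA {n i : ℕ} (h1 : 1 ≤ i) (h2 : i < n) : ¬ Pres n i (sA n i) := by
  intro h
  have := h ⟨i, h2⟩
  rw [sA_val h1 h2] at this
  simp only at this
  split_ifs at this <;> omega

theorem pres_prodA {n i : ℕ} {a : List ℕ} (h : i ∉ a) : Pres n i (prodA n a) := by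
  induction a with
  | nil => exact pres_one n i
  | cons j t ih =>
    rw [prodA_cons]
    simp only [List.mem_cons, not_or] at h
    exact (pres_sA h.1).mul (ih h.2)

theorem not_pres_split {n i : ℕ} {u v : List ℕ} (h1 : 1 ≤ i) (h2 : i < n) (hu : i ∉ u)
    (hv : i ∉ v) : ¬ Pres n i (prodA n (u ++ i :: v)) := by
  intro h
  rw [prodA_append, prodA_cons] at h
  exact not_pres_sA h1 h2 ((h.right (pres_prodA hu)).left (pres_prodA hv))

theorem split_of_nodup {i : ℕ} {a : List ℕ} (ha : a.Nodup) (hi : i ∈ a) :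
    ∃ u v, a = u ++ i :: v ∧ i ∉ u ∧ i ∉ v := by
  obtain ⟨u, v, rfl⟩ := List.append_of_mem hi
  refine ⟨u, v, rfl, ?_, ?_⟩
  · intro h
    have := List.nodup_append.1 ha
    exact this.2.2 i h i (by simp) rfl
  · have := (List.nodup_append.1 ha).2.1
    exact (List.nodup_cons.1 this).1

theorem word_bd {n i : ℕ} {a : List ℕ} (ha : IsWordA n a) (hi : i ∈ a) : 1 ≤ i ∧ i < n := by
  have := ha i hi
  omega

theorem not_pres_of_mem {n i : ℕ} {a : List ℕ} (ha : a.Nodup) (hw : IsWordA n a) (hi : i ∈ a) :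
    ¬ Pres n i (prodA n a) := by
  obtain ⟨h1, h2⟩ := word_bd hw hi
  obtain ⟨u, v, rfl, hu, hv⟩ := split_of_nodup ha hi
  exact not_pres_split h1 h2 hu hv

theorem mem_of_not_pres {n i : ℕ} {a : List ℕ} (h : ¬ Pres n i (prodA n a)) : i ∈ a := by
  by_contra hi
  exact h (pres_prodA hi)

theorem nodup_subset {n : ℕ} {a b : List ℕ} (ha : a.Nodup) (hw : IsWordA n a)
    (h : prodA n b = prodA n a) : a ⊆ b := by
  intro i hi
  apply mem_of_not_pres (n := n)
  rw [h]
  exact not_pres_of_mem ha hw hi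

theorem nodup_reduced {n : ℕ} {a : List ℕ} (ha : a.Nodup) (hw : IsWordA n a) :
    ReducedA n a (prodA n a) :=
  ⟨hw, rfl, fun _ _ h => (List.subperm_of_subset ha (nodup_subset ha hw h)).length_le⟩

theorem reduced_perm {n : ℕ} {a b : List ℕ} (ha : a.Nodup) (hw : IsWordA n a)
    (hb : ReducedA n b (prodA n a)) : a.Perm b :=
  (List.subperm_of_subset ha (nodup_subset ha hw hb.2.1)).perm_of_length_le
    (hb.2.2 a hw rfl)

theorem fix_of_pres {n j : ℕ} {u : Equiv.Perm (Fin n)} (h1 : 1 ≤ j) (h2 : j < n)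
    (hu : Pres n j u) (hs : Pres n j (sA n j * u * sA n j)) :
    Pres n (j - 1) u ∧ Pres n (j + 1) u := by
  have e1 : ∀ x : Fin n, (x : ℕ) = j → (u x : ℕ) = j := by
    intro x hx
    have a1 := hu x
    have a2 := hs (sA n j x)
    simp only [Equiv.Perm.mul_apply] at a2
    rw [show sA n j (sA n j x) = x from by
      rw [← Equiv.Perm.mul_apply, sA_mul_self, Equiv.Perm.one_apply]] at a2
    rw [sA_val h1 h2, sA_val h1 h2] at a2
    split_ifs at a2 <;> omega
  have e2 : ∀ x : Fin n, (x : ℕ) = j - 1 → (u x : ℕ) = j - 1 := by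
    intro x hx
    have a1 := hu x
    have a2 := hs (sA n j x)
    simp only [Equiv.Perm.mul_apply] at a2
    rw [show sA n j (sA n j x) = x from by
      rw [← Equiv.Perm.mul_apply, sA_mul_self, Equiv.Perm.one_apply]] at a2
    rw [sA_val h1 h2, sA_val h1 h2] at a2
    split_ifs at a2 <;> omega
  have f1 : ∀ x : Fin n, (u x : ℕ) = j → (x : ℕ) = j := by
    intro x hx
    have h3 := e1 ⟨j, h2⟩ rfl
    have : u x = u ⟨j, h2⟩ := Fin.ext (by omega)
    rw [u.injective this]
  have f2 : ∀ x : Fin n, (u x : ℕ) = j - 1 → (x : ℕ) = j - 1 := by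
    intro x hx
    have h3 := e2 ⟨j - 1, by omega⟩ rfl
    have : u x = u ⟨j - 1, by omega⟩ := Fin.ext (by omega)
    rw [u.injective this]
  constructor <;> intro x
  · have := hu x; have := e2 x; have := f2 x; omega
  · have := hu x; have := e1 x; have := f1 x; omega

theorem commute_of_pres {n j : ℕ} {u : Equiv.Perm (Fin n)} (h1 : 1 ≤ j) (h2 : j < n)
    (p0 : Pres n (j - 1) u) (p1 : Pres n j u) (p2 : Pres n (j + 1) u) :
    u * sA n j = sA n j * u := by
  have a1 : u ⟨j - 1, by omega⟩ = ⟨j - 1, by omega⟩ := by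
    apply Fin.ext
    have := p0 ⟨j - 1, by omega⟩
    have := p1 ⟨j - 1, by omega⟩
    simp only at *
    omega
  have a2 : u ⟨j, by omega⟩ = ⟨j, by omega⟩ := by
    apply Fin.ext
    have := p1 ⟨j, by omega⟩
    have := p2 ⟨j, by omega⟩
    simp only at *
    omega
  unfold sA
  rw [dif_pos ⟨h1, h2⟩, Equiv.mul_swap_eq_swap_mul, a1, a2]

theorem filter_prod {n : ℕ} (S : ℕ → Bool) (b₁ : List ℕ) : ∀ b₂ : List ℕ, b₁.Nodup → b₂.Nodup →
    IsWordA n b₁ → IsWordA n b₂ → prodA n b₁ = prodA n b₂ →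
    prodA n (b₁.filter S) = prodA n (b₂.filter S) := by
  induction b₁ with
  | nil =>
    intro b₂ _ h2 _ hw2 h
    have := nodup_subset h2 hw2 h
    rw [List.subset_nil.1 this]
  | cons i t ih =>
    intro b₂ h1 h2 hw1 hw2 h
    have hi : i ∈ b₂ := nodup_subset h1 hw1 h.symm (by simp)
    obtain ⟨hi1, hi2⟩ := word_bd hw2 hi
    obtain ⟨u, v, rfl, hu, hv⟩ := split_of_nodup h2 hi
    have hit := (List.nodup_cons.1 h1).1
    have hpu : Pres n i (prodA n u) := pres_prodA hu
    have hun : u.Nodup := (List.nodup_append.1 h2).1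
    have huw : IsWordA n u := fun x hx => hw2 x (by simp [hx])
    rw [prodA_append, prodA_cons, prodA_cons] at h
    have ht : prodA n t = sA n i * prodA n u * sA n i * prodA n v := by
      rw [mul_assoc (sA n i), mul_assoc (sA n i), mul_assoc (prodA n u), ← h, ← mul_assoc,
        sA_mul_self, one_mul]
    have hpt : Pres n i (prodA n t) := pres_prodA hit
    rw [ht] at hpt
    obtain ⟨q1, q2⟩ := fix_of_pres hi1 hi2 hpu (hpt.left (pres_prodA hv))
    have c1 := commute_of_pres hi1 hi2 q1 hpu q2
    have ht2 : prodA n t = prodA n (u ++ v) := by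
      rw [ht, prodA_append, mul_assoc (sA n i), c1, ← mul_assoc (sA n i), sA_mul_self, one_mul]
    have hsub : (u ++ v).Sublist (u ++ i :: v) := by simp
    have IH := ih (u ++ v) (List.nodup_cons.1 h1).2 (hsub.nodup h2)
      (fun x hx => hw1 x (by simp [hx])) (fun x hx => hw2 x (hsub.subset hx)) ht2
    have m1 : i - 1 ∉ u := fun hm => not_pres_of_mem hun huw hm q1
    have m2 : i + 1 ∉ u := fun hm => not_pres_of_mem hun huw hm q2
    have c2 : prodA n (u.filter S) * sA n i = sA n i * prodA n (u.filter S) := by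
      apply commute_of_pres hi1 hi2 <;> apply pres_prodA <;> intro hm
      · exact m1 (List.mem_filter.1 hm).1
      · exact hu (List.mem_filter.1 hm).1
      · exact m2 (List.mem_filter.1 hm).1
    rw [List.filter_append, prodA_append] at IH
    rw [List.filter_append, prodA_append, List.filter_cons, List.filter_cons]
    split_ifs
    · rw [prodA_cons, prodA_cons, IH, ← mul_assoc, ← c2, mul_assoc]
    · exact IH

theorem reduced_of_sublist_nodup {n : ℕ} {a b : List ℕ} (hb : b.Nodup) (hw : IsWordA n b)
    (h : a.Sublist b) : ReducedA n a (prodA n a) :=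
  nodup_reduced (h.nodup hb) (fun x hx => hw x (h.subset hx))

theorem sublist_eq_filter {a b : List ℕ} (hb : b.Nodup) (h : a.Sublist b) :
    a = b.filter (fun x => decide (x ∈ a)) := by
  induction h with
  | slnil => rfl
  | @cons l₁ l₂ x h ih =>
    have hx := (List.nodup_cons.1 hb)
    have : x ∉ l₁ := fun hm => hx.1 (h.subset hm)
    rw [List.filter_cons, if_neg (by simpa using this)]
    exact ih hx.2
  | @cons_cons l₁ l₂ x h ih =>
    have hx := (List.nodup_cons.1 hb)
    rw [List.filter_cons, if_pos (by simp)]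
    congr 1
    conv_lhs => rw [ih hx.2]
    apply List.filter_congr
    intro y hy
    have : y ≠ x := fun e => hx.1 (e ▸ hy)
    simp [this]

/-- elements below a product of a nodup word. -/
theorem below_nodup {n : ℕ} {b : List ℕ} (hb : b.Nodup) (hw : IsWordA n b)
    {v : Equiv.Perm (Fin n)} :
    bruhatA n v (prodA n b) ↔ ∃ S : Finset ℕ, S ⊆ b.toFinset ∧
      v = prodA n (b.filter (fun x => decide (x ∈ S))) := by
  constructor
  · rintro ⟨a, c, ha, hc, hs⟩
    have hp := reduced_perm hb hw hc
    have hcn : c.Nodup := hp.nodup_iff.1 hb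
    refine ⟨a.toFinset, ?_, ?_⟩
    · intro x hx
      have : x ∈ c := hs.subset (List.mem_toFinset.1 hx)
      exact List.mem_toFinset.2 (hp.mem_iff.2 this)
    · rw [← ha.2.1]
      conv_lhs => rw [sublist_eq_filter hcn hs]
      rw [filter_prod _ c b hcn hb hc.1 hw hc.2.1]
      simp
  · rintro ⟨S, _, rfl⟩
    exact ⟨_, b, reduced_of_sublist_nodup hb hw List.filter_sublist, nodup_reduced hb hw,
      List.filter_sublist⟩

theorem boolean_of_nodup {n : ℕ} {b : List ℕ} (hb : b.Nodup) (hw : IsWordA n b) :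
    BooleanA n (prodA n b) := by
  classical
  set F : Finset ℕ → List ℕ := fun S => b.filter (fun x => decide (x ∈ S)) with hF
  have hFn : ∀ S, (F S).Nodup := fun S => hb.filter _
  have hFw : ∀ S, IsWordA n (F S) := fun S x hx => hw x (List.mem_filter.1 hx).1
  have hmem : ∀ S, S ⊆ b.toFinset → ∀ x, x ∈ F S ↔ x ∈ S := by
    intro S hS x
    simp only [hF, List.mem_filter, decide_eq_true_eq]
    exact ⟨fun h => h.2, fun h => ⟨List.mem_toFinset.1 (hS h), h⟩⟩
  have hord : ∀ S T, S ⊆ b.toFinset → T ⊆ b.toFinset →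
      (bruhatA n (prodA n (F S)) (prodA n (F T)) ↔ S ⊆ T) := by
    intro S T hS hT
    constructor
    · rintro ⟨a, c, ha, hc, hs⟩ x hx
      have h1 := reduced_perm (hFn S) (hFw S) ha
      have h2 := reduced_perm (hFn T) (hFw T) hc
      rw [← hmem T hT, h2.mem_iff]
      apply hs.subset
      rw [← h1.mem_iff, hmem S hS]
      exact hx
    · intro hST
      refine ⟨F S, F T, nodup_reduced (hFn S) (hFw S), nodup_reduced (hFn T) (hFw T), ?_⟩
      have : F S = (F T).filter (fun x => decide (x ∈ S)) := by
        simp only [hF, List.filter_filter]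
        apply List.filter_congr
        intro x _
        have := @hST x
        by_cases h : x ∈ S
        · simp [h, this h]
        · simp [h]
      rw [this]
      exact List.filter_sublist
  let r := b.toFinset.card
  let g : Fin r ≃ {x // x ∈ b.toFinset} := b.toFinset.equivFin.symm
  let emb : Fin r ↪ ℕ := g.toEmbedding.trans (Function.Embedding.subtype _)
  have hsubm : ∀ S : Finset (Fin r), S.map emb ⊆ b.toFinset := by
    intro S x hx
    obtain ⟨y, _, rfl⟩ := Finset.mem_map.1 hx
    exact (g y).2
  let φ : Finset (Fin r) → {v : Equiv.Perm (Fin n) // bruhatA n v (prodA n b)} :=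
    fun S => ⟨prodA n (F (S.map emb)), (below_nodup hb hw).2 ⟨_, hsubm S, rfl⟩⟩
  have hφ : ∀ S T, bruhatA n (φ S).1 (φ T).1 ↔ S ⊆ T := by
    intro S T
    rw [hord _ _ (hsubm S) (hsubm T), Finset.map_subset_map]
  have hinj : Function.Injective φ := by
    intro S T h
    apply Finset.Subset.antisymm
    · rw [← hφ, h, hφ]
    · rw [← hφ, h, hφ]
  have hsurj : Function.Surjective φ := by
    rintro ⟨v, hv⟩
    obtain ⟨S, hS, rfl⟩ := (below_nodup hb hw).1 hv
    refine ⟨Finset.univ.filter (fun y => emb y ∈ S), ?_⟩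
    apply Subtype.ext
    show prodA n (F _) = prodA n (F S)
    congr 2
    ext x
    simp only [Finset.mem_map, Finset.mem_filter, Finset.mem_univ, true_and]
    constructor
    · rintro ⟨y, hy, rfl⟩
      exact hy
    · intro hx
      refine ⟨g.symm ⟨x, hS hx⟩, ?_, ?_⟩ <;> simp [emb, hx]
  have hbij : Function.Bijective φ := ⟨hinj, hsurj⟩
  have hinv : ∀ S, (Equiv.ofBijective φ hbij).symm (φ S) = S := fun S =>
    (Equiv.ofBijective φ hbij).symm_apply_apply S
  refine ⟨r, (Equiv.ofBijective φ hbij).symm, ?_⟩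
  intro x y
  obtain ⟨S, rfl⟩ := hsurj x
  obtain ⟨T, rfl⟩ := hsurj y
  rw [hφ, hinv, hinv]

/-! ### Boolean implies a nodup word -/

theorem reduced_left {n : ℕ} {u v : List ℕ} {w : Equiv.Perm (Fin n)}
    (h : ReducedA n (u ++ v) w) : ReducedA n u (prodA n u) := by
  refine ⟨fun x hx => h.1 x (by simp [hx]), rfl, fun c hc e => ?_⟩
  have := h.2.2 (c ++ v) (by
    intro x hx
    rcases List.mem_append.1 hx with h' | h'
    · exact hc x h'
    · exact h.1 x (by simp [h'])) (by rw [prodA_append, e, ← prodA_append, h.2.1])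
  simpa using this

theorem letters_bound {n : ℕ} {q : List ℕ} {j : ℕ} (hq : q.Nodup) (hj : j ∈ q)
    (hr : ReducedA n (q ++ [j]) (prodA n (q ++ [j]))) {c : List ℕ}
    (hc : ReducedA n c (prodA n (q ++ [j]))) : c ⊆ q := by
  have hqw : IsWordA n q := fun x hx => hr.1 x (by simp [hx])
  obtain ⟨hj1, hj2⟩ := word_bd hqw hj
  have hnp : ∀ i ∈ q, ¬ Pres n i (prodA n (q ++ [j])) := by
    intro i hi hp
    by_cases hij : i = j
    · subst hij
      obtain ⟨u, v, rfl, hu, hv⟩ := split_of_nodup hq hi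
      have e : prodA n (u ++ i :: v ++ [i]) =
          prodA n u * (sA n i * prodA n v * sA n i) := by
        rw [prodA_append, prodA_append, prodA_cons, prodA_cons, prodA_nil]
        group
      rw [e] at hp
      have hpv : Pres n i (prodA n v) := pres_prodA hv
      obtain ⟨q1, q2⟩ := fix_of_pres hj1 hj2 hpv (hp.right (pres_prodA hu))
      have c1 := commute_of_pres hj1 hj2 q1 hpv q2
      have := hr.2.2 (u ++ v) (fun x hx => hqw x (by
        rcases List.mem_append.1 hx with h | h <;> simp [h])) (by
          rw [e, prodA_append, mul_assoc (sA n i), c1, ← mul_assoc (sA n i), sA_mul_self, one_mul])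
      simp at this
    · rw [prodA_append] at hp
      exact not_pres_of_mem hq hqw hi (hp.left (pres_prodA (by simpa using hij)))
  have hsub : q ⊆ c := by
    intro i hi
    apply mem_of_not_pres (n := n)
    rw [hc.2.1]
    exact hnp i hi
  intro i hi
  by_contra hiq
  have hsp : List.Subperm (i :: q) c := List.subperm_of_subset (List.nodup_cons.2 ⟨hiq, hq⟩)
    (by intro x hx
        rcases List.mem_cons.1 hx with h | h
        · exact h ▸ hi
        · exact hsub h)
  have hperm : (i :: q).Perm c := hsp.perm_of_length_le (by
    have := hc.2.2 _ hr.1 rfl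
    simpa using this)
  have hcn : c.Nodup := hperm.nodup_iff.1 (List.nodup_cons.2 ⟨hiq, hq⟩)
  apply not_pres_of_mem hcn hc.1 hi
  rw [hc.2.1]
  apply pres_prodA
  simp only [List.mem_append, List.mem_singleton, not_or]
  exact ⟨hiq, fun e => hiq (e ▸ hj)⟩

theorem nodup_of_boolean {n : ℕ} {w : Equiv.Perm (Fin n)} (h : BooleanA n w) :
    ∃ b : List ℕ, b.Nodup ∧ IsWordA n b ∧ prodA n b = w := by
  classical
  obtain ⟨r, e, he⟩ := h
  obtain ⟨-, b, -, hb, -⟩ := (e.symm ∅).2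
  have hbel : ∀ u v, u ++ v = b → bruhatA n (prodA n u) w := by
    intro u v huv
    refine ⟨u, b, ?_, hb, ?_⟩
    · rw [← huv] at hb
      exact reduced_left hb
    · rw [← huv]; simp
  -- the chain bound
  have hchain : ∀ (u v : List ℕ) (huv : u ++ v = b),
      u.length ≤ (e ⟨prodA n u, hbel u v huv⟩).card := by
    intro u
    induction u using List.reverseRecOn with
    | nil => simp
    | append_singleton u i ih =>
      intro v huv
      have huv' : u ++ (i :: v) = b := by rw [← huv]; simp
      have h1 := ih (i :: v) huv'
      have hru : ReducedA n u (prodA n u) := by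
        rw [← huv'] at hb; exact reduced_left hb
      have hrui : ReducedA n (u ++ [i]) (prodA n (u ++ [i])) := by
        rw [← huv] at hb; exact reduced_left hb
      have hss : e ⟨prodA n u, hbel u _ huv'⟩ ⊂ e ⟨prodA n (u ++ [i]), hbel _ v huv⟩ := by
        refine Finset.ssubset_iff_subset_ne.2 ⟨?_, ?_⟩
        · rw [← he]
          exact ⟨u, u ++ [i], hru, hrui, by simp⟩
        · intro hE
          have := Subtype.ext_iff.1 (e.injective hE)
          simp only at this
          have := hrui.2.2 u hru.1 this
          simp at this
      have := Finset.card_lt_card hss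
      rw [List.length_append, List.length_singleton]
      omega
  have key : ∀ (u v : List ℕ), u ++ v = b → u.Nodup := by
    intro u
    induction u using List.reverseRecOn with
    | nil => simp
    | append_singleton q j ih =>
      intro v huv
      have hq : q.Nodup := ih (j :: v) (by rw [← huv]; simp)
      by_contra hnd
      have hj : j ∈ q := by
        by_contra hj
        apply hnd
        rw [List.nodup_append]
        refine ⟨hq, by simp, ?_⟩
        intro x hx y hy hxy
        rw [List.mem_singleton] at hy
        exact hj (by rw [← hy, ← hxy]; exact hx)
      have hr : ReducedA n (q ++ [j]) (prodA n (q ++ [j])) := by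
        rw [← huv] at hb; exact reduced_left hb
      have hch := hchain (q ++ [j]) v huv
      set P := e ⟨prodA n (q ++ [j]), hbel _ v huv⟩ with hP
      have hatom : ∀ x ∈ P, ∃ i ∈ q, (e.symm {x}).1 = sA n i := by
        intro x hx
        have hle : bruhatA n (e.symm {x}).1 (prodA n (q ++ [j])) := by
          have := (he (e.symm {x}) ⟨prodA n (q ++ [j]), hbel _ v huv⟩).2 (by
            rw [Equiv.apply_symm_apply]
            exact Finset.singleton_subset_iff.2 hx)
          exact this
        obtain ⟨a, c, ha, hc, hs⟩ := hle
        obtain ⟨a', b', ha', hb', hs'⟩ := (e.symm {x}).2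
        have h1w : bruhatA n 1 w := hbel [] b rfl
        have hnil : ReducedA n [] (1 : Equiv.Perm (Fin n)) :=
          ⟨by simp [IsWordA], rfl, by simp⟩
        have he1 : e ⟨1, h1w⟩ = ∅ := by
          have : e ⟨1, h1w⟩ ⊆ ∅ := by
            have := (he ⟨1, h1w⟩ (e.symm ∅)).1 (by
              obtain ⟨a0, b0, h0, _, _⟩ := (e.symm ∅).2
              exact ⟨[], a0, hnil, h0, by simp⟩)
            simpa using this
          exact Finset.subset_empty.1 this
        have ha0 : a' ≠ [] := by
          rintro rfl
          have h3 : e.symm {x} = ⟨1, h1w⟩ := Subtype.ext ha'.2.1.symm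
          have h4 : ({x} : Finset (Fin r)) = ∅ := by
            rw [← he1, ← h3, Equiv.apply_symm_apply]
          simp at h4
        have hane : a ≠ [] := by
          rintro rfl
          have := ha'.2.2 [] ha.1 ha.2.1
          simp at this
          exact ha0 this
        obtain ⟨i, t, rfl⟩ := List.exists_cons_of_ne_nil hane
        have hic : i ∈ c := hs.subset (by simp)
        have hiq := letters_bound hq hj hr hc hic
        refine ⟨i, hiq, ?_⟩
        have hiw : IsWordA n [i] := by
          intro y hy
          rw [List.mem_singleton] at hy
          exact ha.1 y (by simp [hy])
        have hri : ReducedA n [i] (sA n i) := by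
          have := nodup_reduced (n := n) (a := [i]) (by simp) hiw
          rwa [prodA_cons, prodA_nil, mul_one] at this
        have hib : bruhatA n (sA n i) w := by
          have hqb : q.Sublist b := by rw [← huv]; simp
          exact ⟨[i], b, hri, hb, (List.singleton_sublist.2 (hqb.subset hiq))⟩
        have hsub : e ⟨sA n i, hib⟩ ⊆ {x} := by
          have := (he ⟨sA n i, hib⟩ (e.symm {x})).1 ⟨[i], i :: t, hri, ha, by simp⟩
          simpa using this
        rcases Finset.subset_singleton_iff.1 hsub with h0 | h0
        · exfalso
          rw [← he1] at h0
          have h5 := Subtype.ext_iff.1 (e.injective h0)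
          simp only at h5
          have := hri.2.2 [] (by simp [IsWordA]) (by rw [h5]; rfl)
          simp at this
        · rw [← h0, Equiv.symm_apply_apply]
      choose! f hf1 hf2 using hatom
      have hcard : P.card ≤ q.toFinset.card := by
        apply Finset.card_le_card_of_injOn f
        · intro x hx
          simpa using hf1 x hx
        · intro x hx y hy hxy
          have h1 := hf2 x hx
          have h2 := hf2 y hy
          rw [hxy, ← h2] at h1
          have := e.symm.injective (Subtype.ext h1)
          simpa using this
      have := List.toFinset_card_le q
      rw [List.length_append, List.length_singleton] at hch
      omega
  exact ⟨b, key b [] (by simp), hb.1, hb.2.1⟩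

/-! ### Patterns -/

def Has321 {n : ℕ} (w : Equiv.Perm (Fin n)) : Prop :=
  ∃ a b c : Fin n, a < b ∧ b < c ∧ w c < w b ∧ w b < w a

def Has3412 {n : ℕ} (w : Equiv.Perm (Fin n)) : Prop :=
  ∃ a b c d : Fin n, a < b ∧ b < c ∧ c < d ∧ w c < w d ∧ w d < w a ∧ w a < w b

theorem contains321 {n : ℕ} (w : Equiv.Perm (Fin n)) : ContainsA w p321 ↔ Has321 w := by
  constructor
  · rintro ⟨f, hf, h⟩
    exact ⟨f 0, f 1, f 2, hf (by decide), hf (by decide), (h 2 1).2 (by decide),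
      (h 1 0).2 (by decide)⟩
  · rintro ⟨a, b, c, h1, h2, h3, h4⟩
    refine ⟨![a, b, c], ?_, ?_⟩
    · intro x y hxy
      fin_cases x <;> fin_cases y <;> simp at hxy ⊢ <;> omega
    · intro x y
      fin_cases x <;> fin_cases y <;> simp [p321] <;> omega

theorem contains3412 {n : ℕ} (w : Equiv.Perm (Fin n)) : ContainsA w p3412 ↔ Has3412 w := by
  constructor
  · rintro ⟨f, hf, h⟩
    exact ⟨f 0, f 1, f 2, f 3, hf (by decide), hf (by decide), hf (by decide),
      (h 2 3).2 (by decide), (h 3 0).2 (by decide), (h 0 1).2 (by decide)⟩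
  · rintro ⟨a, b, c, d, h1, h2, h3, h4, h5, h6⟩
    refine ⟨![a, b, c, d], ?_, ?_⟩
    · intro x y hxy
      fin_cases x <;> fin_cases y <;> simp at hxy ⊢ <;> omega
    · intro x y
      fin_cases x <;> fin_cases y <;> simp [p3412] <;> omega

theorem cross_up {n i : ℕ} {b : List ℕ} (hb : b.Nodup) (hw : IsWordA n b) {x y : Fin n}
    (hx : (x : ℕ) < i) (hy : (y : ℕ) < i) (hx' : i ≤ (prodA n b x : ℕ))
    (hy' : i ≤ (prodA n b y : ℕ)) : x = y := by
  by_cases hi : i ∈ b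
  · obtain ⟨h1, h2⟩ := word_bd hw hi
    obtain ⟨u, v, rfl, hu, hv⟩ := split_of_nodup hb hi
    rw [prodA_append, prodA_cons] at hx' hy'
    simp only [Equiv.Perm.mul_apply] at hx' hy'
    have hpu : Pres n i (prodA n u) := pres_prodA hu
    have hpv : Pres n i (prodA n v) := pres_prodA hv
    have key : ∀ z : Fin n, (z : ℕ) < i → i ≤ (prodA n u (sA n i (prodA n v z)) : ℕ) →
        (prodA n v z : ℕ) = i - 1 := by
      intro z hz hz'
      have a1 := hpu (sA n i (prodA n v z))
      have a2 := hpv z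
      rw [sA_val h1 h2] at a1
      split_ifs at a1 <;> omega
    apply (prodA n v).injective
    apply Fin.ext
    rw [key x hx hx', key y hy hy']
  · have := pres_prodA (n := n) hi x
    omega

theorem cross_down {n i : ℕ} {b : List ℕ} (hb : b.Nodup) (hw : IsWordA n b) {x y : Fin n}
    (hx : i ≤ (x : ℕ)) (hy : i ≤ (y : ℕ)) (hx' : (prodA n b x : ℕ) < i)
    (hy' : (prodA n b y : ℕ) < i) : x = y := by
  by_cases hi : i ∈ b
  · obtain ⟨h1, h2⟩ := word_bd hw hi
    obtain ⟨u, v, rfl, hu, hv⟩ := split_of_nodup hb hi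
    rw [prodA_append, prodA_cons] at hx' hy'
    simp only [Equiv.Perm.mul_apply] at hx' hy'
    have hpu : Pres n i (prodA n u) := pres_prodA hu
    have hpv : Pres n i (prodA n v) := pres_prodA hv
    have key : ∀ z : Fin n, i ≤ (z : ℕ) → (prodA n u (sA n i (prodA n v z)) : ℕ) < i →
        (prodA n v z : ℕ) = i := by
      intro z hz hz'
      have a1 := hpu (sA n i (prodA n v z))
      have a2 := hpv z
      rw [sA_val h1 h2] at a1
      split_ifs at a1 <;> omega
    apply (prodA n v).injective
    apply Fin.ext
    rw [key x hx hx', key y hy hy']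
  · have := pres_prodA (n := n) hi x
    omega

theorem pres_succ_of_fix {n : ℕ} {v : Equiv.Perm (Fin n)} {x : Fin n} (hx : v x = x)  :
    Pres n x v ↔ Pres n (x + 1) v := by
  have h : ∀ y, (v y : ℕ) = x ↔ (y : ℕ) = x := by
    intro y
    rw [← Fin.ext_iff, ← Fin.ext_iff]
    constructor
    · intro h
      exact v.injective (h.trans hx.symm)
    · rintro rfl; exact hx
  constructor <;> intro hp y <;> have h1 := hp y <;> have h2 := h y <;> omega

/-- a nodup word using both letters at a position moves that position. -/
theorem not_fix {n : ℕ} {b : List ℕ} (hb : b.Nodup) (hw : IsWordA n b) {x : Fin n}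
    (h1 : (x : ℕ) ∈ b) (h2 : (x : ℕ) + 1 ∈ b) : prodA n b x ≠ x := by
  obtain ⟨l1, l2⟩ := word_bd hw h1
  obtain ⟨r1, r2⟩ := word_bd hw h2
  obtain ⟨u, v, rfl, hu, hv⟩ := split_of_nodup hb h1
  have hvn : v.Nodup := (List.nodup_cons.1 (List.nodup_append.1 hb).2.1).2
  have hvw : IsWordA n v := fun y hy => hw y (by simp [hy])
  have hun : u.Nodup := (List.nodup_append.1 hb).1
  have huw : IsWordA n u := fun y hy => hw y (by simp [hy])
  have hpu : Pres n x (prodA n u) := pres_prodA hu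
  have hpv : Pres n x (prodA n v) := pres_prodA hv
  intro hfix
  rw [prodA_append, prodA_cons] at hfix
  simp only [Equiv.Perm.mul_apply] at hfix
  have hmem : (x : ℕ) + 1 ∈ u ∨ (x : ℕ) + 1 ∈ v := by
    simpa using h2
  rcases hmem with hm | hm
  · -- `x+1` to the left of `x`
    have hmv : (x : ℕ) + 1 ∉ v := fun h =>
      (List.nodup_append.1 hb).2.2 _ hm ((x : ℕ) + 1) (by simp [h]) rfl
    have hpv' : Pres n (x + 1) (prodA n v) := pres_prodA hmv
    have a1 := hpv x
    have a2 := hpv' x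
    have a3 := hpu (sA n x (prodA n v x))
    rw [hfix, sA_val l1 l2] at a3
    split_ifs at a3 <;> omega
  · have hmu : (x : ℕ) + 1 ∉ u := fun h =>
      (List.nodup_append.1 hb).2.2 _ h ((x : ℕ) + 1) (by simp [hm]) rfl
    have hpu' : Pres n (x + 1) (prodA n u) := pres_prodA hmu
    have hne : prodA n v x ≠ x := by
      intro h
      exact not_pres_of_mem hvn hvw hm ((pres_succ_of_fix h).1 hpv)
    have hne' : (prodA n v x : ℕ) ≠ x := fun h => hne (Fin.ext h)
    have a1 := hpv x
    have a3 := hpu' (sA n x (prodA n v x))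
    rw [hfix, sA_val l1 l2] at a3
    split_ifs at a3 <;> omega

theorem avoids_of_nodup {n : ℕ} {b : List ℕ} (hb : b.Nodup) (hw : IsWordA n b) :
    ¬ Has321 (prodA n b) ∧ ¬ Has3412 (prodA n b) := by
  constructor
  · rintro ⟨p, q, r, h1, h2, h3, h4⟩
    rw [Fin.lt_def] at h1 h2 h3 h4
    rcases lt_trichotomy (prodA n b q : ℕ) q with h | h | h
    · have := cross_down hb hw (i := q) (x := q) (y := r) (by omega) (by omega) h (by omega)
      rw [this] at h2; omega
    · refine not_fix hb hw (x := q) ?_ ?_ (Fin.ext h)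
      · apply mem_of_not_pres (n := n)
        intro hp
        have := hp p
        omega
      · apply mem_of_not_pres (n := n)
        intro hp
        have := hp r
        omega
    · have := cross_up hb hw (i := q + 1) (x := p) (y := q) (by omega) (by omega) (by omega)
        (by omega)
      rw [this] at h1; omega
  · rintro ⟨p, q, r, s, h1, h2, h3, h4, h5, h6⟩
    rw [Fin.lt_def] at h1 h2 h3 h4 h5 h6
    by_cases h : (q : ℕ) + 1 ≤ prodA n b p
    · have := cross_up hb hw (i := q + 1) (x := p) (y := q) (by omega) (by omega) (by omega)
        (by omega)
      rw [this] at h1; omega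
    · have := cross_down hb hw (i := r) (x := r) (y := s) (by omega) (by omega) (by omega)
        (by omega)
      rw [this] at h3; omega

theorem sA_mono {n k : ℕ} (hk : k + 1 < n) {x y : Fin n} (hx : k < (x : ℕ)) (hxy : x < y) :
    sA n (k + 1) x < sA n (k + 1) y := by
  rw [Fin.lt_def] at hxy ⊢
  rw [sA_val (by omega) hk, sA_val (by omega) hk]
  split_ifs <;> omega

/-- In a permutation fixing `{0..k}`, values of later positions are larger than `k`. -/
theorem big_of_fix {n k : ℕ} {w : Equiv.Perm (Fin n)} (h : ∀ x : Fin n, (x : ℕ) ≤ k → w x = x)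
    (x : Fin n) : k < (w x : ℕ) ↔ k < (x : ℕ) := by
  constructor
  · intro h1
    by_contra h2
    rw [h x (by omega)] at h1
    omega
  · intro h1
    by_contra h2
    have := w.injective (h (w x) (by omega))
    rw [this] at h2
    omega

theorem first_big {n k : ℕ} {w : Equiv.Perm (Fin n)} (h : ∀ x : Fin n, (x : ℕ) ≤ k → w x = x)
    {x y : Fin n} (hxy : x < y) (hw : w y < w x) : k < (x : ℕ) := by
  by_contra h1
  have h2 := h x (by omega)
  have h3 := big_of_fix h y
  by_cases h4 : k < (y : ℕ)
  · have := h3.2 h4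
    rw [h2] at hw
    rw [Fin.lt_def] at hw
    omega
  · rw [h2, h y (by omega)] at hw
    exact absurd hw (not_lt.2 hxy.le)

theorem exists_nodup {n : ℕ} (m : ℕ) : ∀ (k : ℕ) (w : Equiv.Perm (Fin n)), n ≤ k + m →
    (∀ x : Fin n, (x : ℕ) < k → w x = x) → ¬ Has321 w → ¬ Has3412 w →
    ∃ b : List ℕ, b.Nodup ∧ (∀ i ∈ b, k + 1 ≤ i ∧ i < n) ∧ prodA n b = w := by
  induction m with
  | zero =>
    intro k w hk hfix _ _
    refine ⟨[], by simp, by simp, ?_⟩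
    rw [prodA_nil]
    ext x
    rw [hfix x (by omega)]
    rfl
  | succ m ih =>
    intro k w hk hfix h321 h3412
    by_cases hkn : n ≤ k
    · exact (ih k w (by omega) hfix h321 h3412)
    push Not at hkn
    let K : Fin n := ⟨k, hkn⟩
    have hKv : (K : ℕ) = k := rfl
    by_cases hwk : w K = K
    · have hfix' : ∀ x : Fin n, (x : ℕ) < k + 1 → w x = x := by
        intro x hx
        by_cases h : (x : ℕ) < k
        · exact hfix x h
        · have : x = K := Fin.ext (by omega)
          rw [this, hwk]
      obtain ⟨b, hb1, hb2, hb3⟩ := ih (k + 1) w (by omega) hfix' h321 h3412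
      exact ⟨b, hb1, fun i hi => by have := hb2 i hi; omega, hb3⟩
    -- values at positions `≥ k` are `≥ k`
    have hge : ∀ x : Fin n, k ≤ (x : ℕ) → k ≤ (w x : ℕ) := by
      intro x hx
      by_contra h
      have := w.injective (hfix (w x) (by omega))
      rw [this] at h
      omega
    have hwK : k < (w K : ℕ) := by
      have := hge K (le_of_eq rfl)
      have h2 : (w K : ℕ) ≠ k := fun h => hwk (Fin.ext h)
      omega
    have hk1 : k + 1 < n := by have := (w K).2; omega
    let L : Fin n := ⟨k + 1, hk1⟩
    have hLv : (L : ℕ) = k + 1 := rfl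
    have hsK : sA n (k + 1) K = L := by
      apply Fin.ext
      rw [sA_val (by omega) hk1]
      simp [K, L]
    have hsL : sA n (k + 1) L = K := by
      apply Fin.ext
      rw [sA_val (by omega) hk1]
      simp [K, L]
    have hss : ∀ x, sA n (k + 1) (sA n (k + 1) x) = x := by
      intro x
      rw [← Equiv.Perm.mul_apply, sA_mul_self, Equiv.Perm.one_apply]
    have hsx : ∀ x : Fin n, (x : ℕ) < k → sA n (k + 1) x = x := by
      intro x hx
      apply Fin.ext
      rw [sA_val (by omega) hk1]
      split_ifs <;> omega
    have hdich : w L = K ∨ w K = L := by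
      by_contra hcon
      push Not at hcon
      obtain ⟨c1, c2⟩ := hcon
      obtain ⟨B, hB⟩ := w.surjective K
      obtain ⟨D, hD⟩ := w.surjective L
      have n1 : w L ≠ w K := fun h => by
        have := congrArg Fin.val (w.injective h); omega
      have n2 : B ≠ K := by rintro rfl; exact hwk hB
      have n3 : B ≠ L := by rintro rfl; exact c1 hB
      have n4 : D ≠ K := by rintro rfl; exact c2 hD
      have hwK2 : (w K : ℕ) ≠ k + 1 := fun h => c2 (Fin.ext h)
      have n5 : B ≠ D := by
        rintro rfl
        have := congrArg Fin.val (hB.symm.trans hD); omega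
      have hBk : k ≤ (B : ℕ) := by
        by_contra h
        have := hfix B (by omega)
        rw [hB] at this
        exact n2 this.symm
      have hDk : k ≤ (D : ℕ) := by
        by_contra h
        have := hfix D (by omega)
        rw [hD] at this
        have := congrArg Fin.val this
        omega
      have hwLk := hge L (by omega)
      have hwLk' : (w L : ℕ) ≠ k := fun h => c1 (Fin.ext h)
      rw [Ne, Fin.ext_iff] at n1 n2 n3 n4 n5
      have hBv : (w B : ℕ) = k := by rw [hB]
      have hDv : (w D : ℕ) = k + 1 := by rw [hD]
      have s1 : (w K : ℕ) < w L := by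
        by_contra h
        exact h321 ⟨K, L, B, by rw [Fin.lt_def]; omega, by rw [Fin.lt_def]; omega,
          by rw [Fin.lt_def]; omega, by rw [Fin.lt_def]; omega⟩
      have s2 : (B : ℕ) < D := by
        by_contra h
        exact h321 ⟨K, D, B, by rw [Fin.lt_def]; omega, by rw [Fin.lt_def]; omega,
          by rw [Fin.lt_def]; omega, by rw [Fin.lt_def]; omega⟩
      exact h3412 ⟨K, L, B, D, by rw [Fin.lt_def]; omega, by rw [Fin.lt_def]; omega,
          by rw [Fin.lt_def]; omega, by rw [Fin.lt_def]; omega, by rw [Fin.lt_def]; omega,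
          by rw [Fin.lt_def]; omega⟩
    rcases hdich with hc | hc
    · -- remove the letter on the right
      have hfix' : ∀ x : Fin n, (x : ℕ) ≤ k → (w * sA n (k + 1)) x = x := by
        intro x hx
        rw [Equiv.Perm.mul_apply]
        by_cases h : (x : ℕ) < k
        · rw [hsx x h, hfix x h]
        · have : x = K := Fin.ext (by omega)
          rw [this, hsK, hc]
      obtain ⟨b, hb1, hb2, hb3⟩ := ih (k + 1) (w * sA n (k + 1)) (by omega)
        (fun x hx => hfix' x (by omega))
        (by
          rintro ⟨p, q, r, h1, h2, h3, h4⟩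
          have g1 := first_big hfix' h1 h4
          have g2 : k < (q : ℕ) := by rw [Fin.lt_def] at h1; omega
          exact h321 ⟨_, _, _, sA_mono hk1 g1 h1, sA_mono hk1 g2 h2, h3, h4⟩)
        (by
          rintro ⟨p, q, r, s, h1, h2, h3, h4, h5, h6⟩
          have g1 := first_big hfix' (h1.trans h2) (h4.trans h5)
          have g2 : k < (q : ℕ) := by rw [Fin.lt_def] at h1; omega
          have g3 : k < (r : ℕ) := by rw [Fin.lt_def] at h2; omega
          exact h3412 ⟨_, _, _, _, sA_mono hk1 g1 h1, sA_mono hk1 g2 h2, sA_mono hk1 g3 h3,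
            h4, h5, h6⟩)
      refine ⟨b ++ [k + 1], ?_, ?_, ?_⟩
      · rw [List.nodup_append]
        refine ⟨hb1, by simp, ?_⟩
        intro x hx y hy hxy
        rw [List.mem_singleton] at hy
        have := hb2 x hx
        omega
      · intro i hi
        rcases List.mem_append.1 hi with h | h
        · have := hb2 i h; omega
        · rw [List.mem_singleton] at h; omega
      · rw [prodA_append, hb3, prodA_cons, prodA_nil, mul_one, mul_assoc, sA_mul_self, mul_one]
    · -- remove the letter on the left
      have hfix' : ∀ x : Fin n, (x : ℕ) ≤ k → (sA n (k + 1) * w) x = x := by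
        intro x hx
        rw [Equiv.Perm.mul_apply]
        by_cases h : (x : ℕ) < k
        · rw [hfix x h, hsx x h]
        · have : x = K := Fin.ext (by omega)
          rw [this, hc, hsL]
      have hmono : ∀ x y : Fin n, k < (x : ℕ) → (sA n (k + 1) * w) x < (sA n (k + 1) * w) y →
          w x < w y := by
        intro x y hx hxy
        have := sA_mono hk1 ((big_of_fix hfix' x).2 hx) hxy
        simpa only [Equiv.Perm.mul_apply, hss] using this
      obtain ⟨b, hb1, hb2, hb3⟩ := ih (k + 1) (sA n (k + 1) * w) (by omega)
        (fun x hx => hfix' x (by omega))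
        (by
          rintro ⟨p, q, r, h1, h2, h3, h4⟩
          have g1 := first_big hfix' h1 h4
          have g2 : k < (q : ℕ) := by rw [Fin.lt_def] at h1; omega
          have g3 : k < (r : ℕ) := by rw [Fin.lt_def] at h2; omega
          exact h321 ⟨p, q, r, h1, h2, hmono _ _ g3 h3, hmono _ _ g2 h4⟩)
        (by
          rintro ⟨p, q, r, s, h1, h2, h3, h4, h5, h6⟩
          have g1 := first_big hfix' (h1.trans h2) (h4.trans h5)
          have g2 : k < (q : ℕ) := by rw [Fin.lt_def] at h1; omega
          have g3 : k < (r : ℕ) := by rw [Fin.lt_def] at h2; omega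
          have g4 : k < (s : ℕ) := by rw [Fin.lt_def] at h3; omega
          exact h3412 ⟨p, q, r, s, h1, h2, h3, hmono _ _ g3 h4, hmono _ _ g4 h5,
            hmono _ _ g1 h6⟩)
      refine ⟨(k + 1) :: b, ?_, ?_, ?_⟩
      · rw [List.nodup_cons]
        refine ⟨fun h => ?_, hb1⟩
        have := hb2 _ h
        omega
      · intro i hi
        rcases List.mem_cons.1 hi with h | h
        · omega
        · have := hb2 i h; omega
      · rw [prodA_cons, hb3, ← mul_assoc, sA_mul_self, one_mul]

theorem stmt0 (n : ℕ) (w : Equiv.Perm (Fin n)) :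
    BooleanA n w ↔ (AvoidsA w p321 ∧ AvoidsA w p3412) := by
  unfold AvoidsA
  rw [contains321, contains3412]
  constructor
  · intro h
    obtain ⟨b, hb, hw, rfl⟩ := nodup_of_boolean h
    exact avoids_of_nodup hb hw
  · rintro ⟨h1, h2⟩
    obtain ⟨b, hb, hw, rfl⟩ := exists_nodup n 0 w (by omega) (by simp) h1 h2
    exact boolean_of_nodup hb (fun i hi => by have := hw i hi; omega)

end Paper
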